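/- arXiv:1911.00251 — 2 statements merged into one kernel-verified Lean document; each statement's English description precedes it below -/
import Mathlib

section
/- Let E be a real Hilbert space, let f : E → ℝ be convex and differentiable everywhere with gradient ∇f, let ρ ∈ (0, 1], λ ≥ 0, and fix x₀ ∈ E and g ∈ E. Define the surrogate function φ(x) = ρ f(x) + λ‖x − x₀‖² + (1 − ρ) ⟨x − x₀, g⟩, and let x̂ ∈ E be a point at which φ attains a global minimum (equivalently, at which the gradient of φ vanishes: ρ∇f(x̂) + 2λ(x̂ − x₀) + (1 − ρ) g = 0). Define G = ρ ∇f(x₀) + (1 − ρ) g. Then ⟨x̂ − x₀, G⟩ ≤ −λ ‖x̂ − x₀‖²; in particular, x̂ − x₀ is a descent direction for the direction estimate G whenever λ > 0 and x̂ ≠ x₀. -/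
open RealInnerProductSpace

/-- A convex function lies above its tangent hyperplanes. -/
theorem ConvexOn.add_inner_le_of_hasGradientAt {E : Type*} [NormedAddCommGroup E]
    [InnerProductSpace ℝ E] [CompleteSpace E] {s : Set E} {f : E → ℝ} {f' x y : E}
    (hf : ConvexOn ℝ s f) (hx : x ∈ s) (hy : y ∈ s) (hgrad : HasGradientAt f f' x) :
    f x + ⟪y - x, f'⟫ ≤ f y := by
  have hline : HasDerivAt (f ∘ AffineMap.lineMap (k := ℝ) x y) ⟪f', y - x⟫ 0 := by
    have h : HasFDerivAt f (InnerProductSpace.toDual ℝ E f')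
        (AffineMap.lineMap (k := ℝ) x y 0) := by
      simpa using hgrad.hasFDerivAt
    simpa using h.comp_hasDerivAt (0 : ℝ) AffineMap.hasDerivAt_lineMap
  have hconv := hf.comp_affineMap (AffineMap.lineMap (k := ℝ) x y)
  have h := hconv.le_slope_of_hasDerivAt (x := 0) (y := 1) (by simpa using hx)
    (by simpa using hy) one_pos hline
  simp only [slope_def_field, Function.comp_apply, AffineMap.lineMap_apply_zero,
    AffineMap.lineMap_apply_one, sub_zero, div_one] at h
  rw [real_inner_comm]
  linarith

/-- First key inequality in the proof of Proposition 4: the minimizer of the SCA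
surrogate gives a descent direction for the gradient estimate G. -/
theorem stmt_7 {E : Type*} [NormedAddCommGroup E] [InnerProductSpace ℝ E] [CompleteSpace E]
    (f : E → ℝ) (f' : E → E)
    (hconv : ConvexOn ℝ Set.univ f)
    (hgrad : ∀ x, HasGradientAt f (f' x) x)
    (ρ lam : ℝ) (hρ : ρ ∈ Set.Ioc (0 : ℝ) 1) (hlam : 0 ≤ lam)
    (x₀ g : E) (φ : E → ℝ)
    (hφ : ∀ x, φ x = ρ * f x + lam * ‖x - x₀‖ ^ 2 + (1 - ρ) * ⟪x - x₀, g⟫)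
    (xhat : E) (hmin : ∀ x, φ xhat ≤ φ x)
    (G : E) (hG : G = ρ • f' x₀ + (1 - ρ) • g) :
    ⟪xhat - x₀, G⟫ ≤ -lam * ‖xhat - x₀‖ ^ 2 := by
  have hmin₀ := hmin x₀
  simp only [hφ, sub_self, norm_zero, inner_zero_left] at hmin₀
  have htangent := hconv.add_inner_le_of_hasGradientAt (Set.mem_univ x₀) (Set.mem_univ xhat)
    (hgrad x₀)
  have hscaled := mul_le_mul_of_nonneg_left htangent hρ.1.le
  rw [hG, inner_add_right, real_inner_smul_right, real_inner_smul_right]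
  linarith
end

section
/- Let E be a real Hilbert space and let f : E → ℝ be differentiable everywhere with L-Lipschitz gradient, L ≥ 0. Fix x, x̂, G ∈ E, γ ≥ 0, and λ ≥ 0, and suppose ⟨x̂ − x, G⟩ ≤ −λ‖x̂ − x‖². Then the updated point x⁺ = x + γ(x̂ − x) satisfies f(x⁺) ≤ f(x) − γ(λ − (L/2)γ)‖x̂ − x‖² + γ ‖∇f(x) − G‖ · ‖x̂ − x‖. -/
open RealInnerProductSpace

/-- The descent lemma: a function with `L`-Lipschitz gradient lies below its quadratic model. -/
theorem le_add_inner_add_of_lipschitz_gradient {E : Type*} [NormedAddCommGroup E]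
    [InnerProductSpace ℝ E] [CompleteSpace E] {f : E → ℝ} {f' : E → E} {L : ℝ}
    (hgrad : ∀ x, HasGradientAt f (f' x) x)
    (hlip : ∀ x y, ‖f' x - f' y‖ ≤ L * ‖x - y‖) (x v : E) :
    f (x + v) ≤ f x + ⟪f' x, v⟫ + L / 2 * ‖v‖ ^ 2 := by
  have hline (t : ℝ) : HasDerivAt (fun s : ℝ => f (x + s • v)) ⟪f' (x + t • v), v⟫ t := by
    have hv : HasDerivAt (fun s : ℝ => x + s • v) v t := by
      simpa using ((hasDerivAt_id t).smul_const v).const_add x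
    exact (hgrad (x + t • v)).hasFDerivAt.comp_hasDerivAt t hv
  have hmodel (t : ℝ) : HasDerivAt (fun s : ℝ => f x + s * ⟪f' x, v⟫ + L / 2 * ‖v‖ ^ 2 * s ^ 2)
      (⟪f' x, v⟫ + L * ‖v‖ ^ 2 * t) t := by
    refine ((((hasDerivAt_id t).mul_const ⟪f' x, v⟫).const_add (f x)).add
      ((hasDerivAt_pow 2 t).const_mul (L / 2 * ‖v‖ ^ 2))).congr_deriv ?_
    push_cast
    ring
  have key := image_le_of_deriv_right_le_deriv_boundary (a := 0) (b := 1)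
    (fun t _ => (hline t).continuousAt.continuousWithinAt)
    (fun t _ => (hline t).hasDerivWithinAt) (by simp)
    (fun t _ => (hmodel t).continuousAt.continuousWithinAt)
    (fun t _ => (hmodel t).hasDerivWithinAt) (fun t ht => by
      have hcs : ⟪f' (x + t • v) - f' x, v⟫ ≤ ‖f' (x + t • v) - f' x‖ * ‖v‖ :=
        real_inner_le_norm _ _
      have hl := hlip (x + t • v) x
      rw [add_sub_cancel_left, norm_smul, Real.norm_of_nonneg ht.1] at hl
      have hmul := mul_le_mul_of_nonneg_right hl (norm_nonneg v)
      rw [inner_sub_left] at hcs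
      linarith) (Set.right_mem_Icc.2 zero_le_one)
  simpa using key

/-- Per-iteration descent inequality in the proof of Proposition 4. -/
theorem stmt_8 {E : Type*} [NormedAddCommGroup E] [InnerProductSpace ℝ E] [CompleteSpace E]
    (f : E → ℝ) (f' : E → E) (L : ℝ) (hL : 0 ≤ L)
    (hgrad : ∀ x, HasGradientAt f (f' x) x)
    (hlip : ∀ x y, ‖f' x - f' y‖ ≤ L * ‖x - y‖)
    (x xhat G : E) (γ lam : ℝ) (hγ : 0 ≤ γ) (hlam : 0 ≤ lam)
    (hdesc : ⟪xhat - x, G⟫ ≤ -lam * ‖xhat - x‖ ^ 2)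
    (xplus : E) (hx : xplus = x + γ • (xhat - x)) :
    f xplus ≤ f x - γ * (lam - (L / 2) * γ) * ‖xhat - x‖ ^ 2
      + γ * ‖f' x - G‖ * ‖xhat - x‖ := by
  subst hx
  have hdl := le_add_inner_add_of_lipschitz_gradient hgrad hlip x (γ • (xhat - x))
  rw [real_inner_smul_right, norm_smul, Real.norm_of_nonneg hγ] at hdl
  have hcs : ⟪f' x - G, xhat - x⟫ ≤ ‖f' x - G‖ * ‖xhat - x‖ := real_inner_le_norm _ _
  rw [inner_sub_left, real_inner_comm (xhat - x) G] at hcs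
  have hinner : ⟪f' x, xhat - x⟫ ≤ -lam * ‖xhat - x‖ ^ 2 + ‖f' x - G‖ * ‖xhat - x‖ := by
    linarith
  have hmul := mul_le_mul_of_nonneg_left hinner hγ
  linarith
end
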